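/- Given a conformal structure on U ⊆ ℝ^V for a triangle collection 𝒯, suppose f : (−ε, ε) → U is a smooth curve with K_i(f(t)) = 0 for every vertex i and every t ∈ (−ε, ε). If at t = 0 the dual length ℓ*_ij is strictly positive for every edge {i,j} and the graph on V whose edges are the edges of 𝒯 is connected, then f′(0) is a constant function on V (i.e., f_i′(0) = f_j′(0) for all i, j ∈ V). -/

import Mathlib

open Finset

/-- The angle at the vertex of a Euclidean triangle whose two adjacent sides have
lengths `a`, `b` and whose opposite side has length `c` (law of cosines). -/
noncomputable def triAngle (a b c : ℝ) : ℝ :=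
  Real.arccos ((a ^ 2 + b ^ 2 - c ^ 2) / (2 * a * b))

/-- `{i, j}` is an edge of the triangle collection `𝒯`. -/
def IsEdge {V : Type*} [DecidableEq V] (𝒯 : Finset (Finset V)) (i j : V) : Prop :=
  i ≠ j ∧ ∃ T ∈ 𝒯, i ∈ T ∧ j ∈ T

instance {V : Type*} [DecidableEq V] (𝒯 : Finset (Finset V)) (i j : V) :
    Decidable (IsEdge 𝒯 i j) := by
  unfold IsEdge; infer_instance

/-- A (two-dimensional) conformal structure on an open set `U ⊆ ℝ^V` for a collection
`𝒯` of triangles: a smooth assignment `f ↦ d f i j` of reals to ordered edges, where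
`d f i j` depends only on the coordinates `f i` and `f j`, the induced lengths
`ℓ i j = d i j + d j i` are positive and satisfy the strict triangle inequality on each
triangle, the metric condition holds on each triangle, and `∂ℓ_ij/∂f_i = d_ij`. -/
structure Conformal2D (V : Type*) [Fintype V] [DecidableEq V]
    (𝒯 : Finset (Finset V)) (U : Set (V → ℝ)) where
  d : (V → ℝ) → V → V → ℝ
  openU : IsOpen U
  card3 : ∀ T ∈ 𝒯, T.card = 3
  smooth : ∀ i j, IsEdge 𝒯 i j → ContDiffOn ℝ (⊤ : ℕ∞) (fun f => d f i j) U
  localDep : ∀ i j, IsEdge 𝒯 i j → ∀ f g : V → ℝ, f i = g i → f j = g j →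
    d f i j = d g i j
  lenPos : ∀ f ∈ U, ∀ i j, IsEdge 𝒯 i j → 0 < d f i j + d f j i
  triIneq : ∀ f ∈ U, ∀ T ∈ 𝒯, ∀ i ∈ T, ∀ j ∈ T, ∀ k ∈ T, i ≠ j → i ≠ k → j ≠ k →
    d f i j + d f j i < (d f i k + d f k i) + (d f j k + d f k j)
  metricCond : ∀ f ∈ U, ∀ T ∈ 𝒯, ∀ i ∈ T, ∀ j ∈ T, ∀ k ∈ T, i ≠ j → i ≠ k → j ≠ k →
    d f i j ^ 2 + d f j k ^ 2 + d f k i ^ 2 = d f j i ^ 2 + d f k j ^ 2 + d f i k ^ 2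
  derivLen : ∀ i j, IsEdge 𝒯 i j → ∀ f ∈ U,
    HasDerivAt (fun s : ℝ =>
        d (Function.update f i s) i j + d (Function.update f i s) j i)
      (d f i j) (f i)

namespace Conformal2D

variable {V : Type*} [Fintype V] [DecidableEq V] {𝒯 : Finset (Finset V)}
  {U : Set (V → ℝ)}

/-- The length `ℓ_ij = d_ij + d_ji`. -/
noncomputable def len (C : Conformal2D V 𝒯 U) (f : V → ℝ) (i j : V) : ℝ :=
  C.d f i j + C.d f j i

/-- The angle `γ_{i,jk}` at vertex `i` in the triangle `{i, j, k}`. -/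
noncomputable def ang (C : Conformal2D V 𝒯 U) (f : V → ℝ) (i j k : V) : ℝ :=
  triAngle (C.len f i j) (C.len f i k) (C.len f j k)

/-- `h_{ij,k} = (d_ik − d_ij cos γ_{i,jk}) / sin γ_{i,jk}`. -/
noncomputable def hh (C : Conformal2D V 𝒯 U) (f : V → ℝ) (i j k : V) : ℝ :=
  (C.d f i k - C.d f i j * Real.cos (C.ang f i j k)) / Real.sin (C.ang f i j k)

/-- The curvature `K_i = 2π − Σ_{{i,j,k} ∈ 𝒯} γ_{i,jk}` (each unordered triangle
containing `i` counted once; the ordered double sum counts it twice, whence `1/2`). -/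
noncomputable def K (C : Conformal2D V 𝒯 U) (f : V → ℝ) (i : V) : ℝ :=
  2 * Real.pi - (1 / 2) * ∑ j : V, ∑ k : V,
    if ({i, j, k} : Finset V) ∈ 𝒯 ∧ i ≠ j ∧ i ≠ k ∧ j ≠ k then C.ang f i j k else 0

/-- The dual length `ℓ*_ij = Σ_{{i,j,k} ∈ 𝒯} h_{ij,k}`. -/
noncomputable def dualLen (C : Conformal2D V 𝒯 U) (f : V → ℝ) (i j : V) : ℝ :=
  ∑ k : V,
    if ({i, j, k} : Finset V) ∈ 𝒯 ∧ i ≠ j ∧ i ≠ k ∧ j ≠ k then C.hh f i j k else 0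

end Conformal2D

section Angle

variable {a b c : ℝ}

theorem triAngle_comm (a b c : ℝ) : triAngle a b c = triAngle b a c := by
  unfold triAngle
  congr 1
  ring

theorem cos_arg_mem_Ioo (ha : 0 < a) (hb : 0 < b)
    (hab : c < a + b) (hac : a < b + c) (hbc : b < a + c) :
    (a ^ 2 + b ^ 2 - c ^ 2) / (2 * a * b) ∈ Set.Ioo (-1) 1 := by
  have h : 0 < 2 * a * b := by positivity
  constructor
  · rw [lt_div_iff₀ h]
    nlinarith
  · rw [div_lt_one h]
    nlinarith

theorem cos_triAngle (ha : 0 < a) (hb : 0 < b)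
    (hab : c < a + b) (hac : a < b + c) (hbc : b < a + c) :
    Real.cos (triAngle a b c) = (a ^ 2 + b ^ 2 - c ^ 2) / (2 * a * b) := by
  have h := cos_arg_mem_Ioo ha hb hab hac hbc
  exact Real.cos_arccos h.1.le h.2.le

theorem sin_triAngle_pos (ha : 0 < a) (hb : 0 < b)
    (hab : c < a + b) (hac : a < b + c) (hbc : b < a + c) :
    0 < Real.sin (triAngle a b c) := by
  have h := cos_arg_mem_Ioo ha hb hab hac hbc
  rw [triAngle, Real.sin_arccos]
  apply Real.sqrt_pos.2
  nlinarith [h.1, h.2]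

/-- The derivative of an angle of a Euclidean triangle with varying side lengths. -/
theorem HasDerivAt.triAngle {a b c : ℝ → ℝ} {a' b' c' t : ℝ}
    (da : HasDerivAt a a' t) (db : HasDerivAt b b' t) (dc : HasDerivAt c c' t)
    (ha : 0 < a t) (hb : 0 < b t)
    (hab : c t < a t + b t) (hac : a t < b t + c t) (hbc : b t < a t + c t) :
    HasDerivAt (fun s => _root_.triAngle (a s) (b s) (c s))
      ((c t * c' - a t * a' - b t * b' +
          (a' * b t + a t * b') * Real.cos (_root_.triAngle (a t) (b t) (c t))) /
        (a t * b t * Real.sin (_root_.triAngle (a t) (b t) (c t)))) t := by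
  have h := cos_arg_mem_Ioo ha hb hab hac hbc
  have hs := sin_triAngle_pos ha hb hab hac hbc
  have dx := (((da.pow 2).add (db.pow 2)).sub (dc.pow 2)).div
    ((da.const_mul 2).mul db) (by positivity : 2 * a t * b t ≠ 0)
  have hcomp := (Real.hasDerivAt_arccos h.1.ne' h.2.ne).comp t dx
  refine hcomp.congr_deriv ?_
  rw [← Real.sin_arccos, cos_triAngle ha hb hab hac hbc]
  change -(1 / Real.sin (_root_.triAngle (a t) (b t) (c t))) * _ = _
  have := hs.ne'
  simp only [Pi.add_apply, Pi.sub_apply, Pi.pow_apply, Pi.mul_apply]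
  field_simp
  ring

end Angle

theorem IsEdge.symm {V : Type*} [DecidableEq V] {𝒯 : Finset (Finset V)} {i j : V}
    (h : IsEdge 𝒯 i j) : IsEdge 𝒯 j i :=
  let ⟨hne, T, hT, hi, hj⟩ := h
  ⟨hne.symm, T, hT, hj, hi⟩

namespace Conformal2D

variable {V : Type*} [Fintype V] [DecidableEq V] {𝒯 : Finset (Finset V)}
  {U : Set (V → ℝ)} (C : Conformal2D V 𝒯 U)

theorem len_comm (f : V → ℝ) (i j : V) : C.len f i j = C.len f j i :=
  add_comm _ _

theorem ang_comm (f : V → ℝ) (i j k : V) : C.ang f i j k = C.ang f i k j := by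
  rw [ang, ang, triAngle_comm, C.len_comm f j k]

theorem differentiableAt_len {i j : V} (h : IsEdge 𝒯 i j) {x : V → ℝ} (hx : x ∈ U) :
    DifferentiableAt ℝ (fun y => C.len y i j) x := by
  have hn := C.openU.mem_nhds hx
  exact (((C.smooth i j h).contDiffAt hn).differentiableAt (by simp)).add
    (((C.smooth j i h.symm).contDiffAt hn).differentiableAt (by simp))

theorem hasDerivAt_len_update {i j : V} (h : IsEdge 𝒯 i j) {x : V → ℝ} (hx : x ∈ U) (k : V) :
    HasDerivAt (fun s => C.len (Function.update x k s) i j)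
      (fderiv ℝ (fun y => C.len y i j) x (Pi.single k 1)) (x k) := by
  have hF := (C.differentiableAt_len h hx).hasFDerivAt
  nth_rw 2 [← Function.update_eq_self k x] at hF
  exact hF.comp_hasDerivAt (x k) (hasDerivAt_update x k (x k))

theorem fderiv_len_single_left {i j : V} (h : IsEdge 𝒯 i j) {x : V → ℝ} (hx : x ∈ U) :
    fderiv ℝ (fun y => C.len y i j) x (Pi.single i 1) = C.d x i j :=
  (C.hasDerivAt_len_update h hx i).unique (C.derivLen i j h x hx)

theorem fderiv_len_single_right {i j : V} (h : IsEdge 𝒯 i j) {x : V → ℝ} (hx : x ∈ U) :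
    fderiv ℝ (fun y => C.len y i j) x (Pi.single j 1) = C.d x j i := by
  simp_rw [C.len_comm _ i j]
  exact C.fderiv_len_single_left h.symm hx

theorem fderiv_len_single_of_ne {i j k : V} (h : IsEdge 𝒯 i j) (hi : k ≠ i) (hj : k ≠ j)
    {x : V → ℝ} (hx : x ∈ U) :
    fderiv ℝ (fun y => C.len y i j) x (Pi.single k 1) = 0 := by
  refine (C.hasDerivAt_len_update h hx k).unique
    ((hasDerivAt_const (x k) (C.len x i j)).congr_of_eventuallyEq
      (Filter.Eventually.of_forall fun s => ?_))
  have hxi : Function.update x k s i = x i := Function.update_of_ne hi.symm _ _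
  have hxj : Function.update x k s j = x j := Function.update_of_ne hj.symm _ _
  exact congrArg₂ (· + ·) (C.localDep i j h _ _ hxi hxj) (C.localDep j i h.symm _ _ hxj hxi)

theorem hasDerivAt_len {i j : V} (h : IsEdge 𝒯 i j) {f : ℝ → V → ℝ} {v : V → ℝ} {t : ℝ}
    (hf : HasDerivAt f v t) (ht : f t ∈ U) :
    HasDerivAt (fun s => C.len (f s) i j)
      (C.d (f t) i j * v i + C.d (f t) j i * v j) t := by
  refine ((C.differentiableAt_len h ht).hasFDerivAt.comp_hasDerivAt t hf).congr_deriv ?_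
  have hv : v = ∑ k, v k • (Pi.single k 1 : V → ℝ) := by
    ext l
    simp [Finset.sum_apply, Pi.single_apply]
  conv_lhs => rw [hv, map_sum]
  rw [Finset.sum_eq_add i j h.1]
  · rw [map_smul, map_smul, C.fderiv_len_single_left h ht, C.fderiv_len_single_right h ht,
      smul_eq_mul, smul_eq_mul]
    ring
  · intro k _ hk
    rw [map_smul, C.fderiv_len_single_of_ne h hk.1 hk.2 ht, smul_zero]
  · exact fun hi => absurd (Finset.mem_univ i) hi
  · exact fun hj => absurd (Finset.mem_univ j) hj

theorem hasDerivAt_ang {i j k : V} (hT : {i, j, k} ∈ 𝒯) (hij : i ≠ j) (hik : i ≠ k)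
    (hjk : j ≠ k) {f : ℝ → V → ℝ} {v : V → ℝ} {t : ℝ}
    (hf : HasDerivAt f v t) (ht : f t ∈ U) :
    HasDerivAt (fun s => C.ang (f s) i j k)
      (C.hh (f t) i j k / C.len (f t) i j * (v j - v i) +
        C.hh (f t) i k j / C.len (f t) i k * (v k - v i)) t := by
  have mi : i ∈ ({i, j, k} : Finset V) := by simp
  have mj : j ∈ ({i, j, k} : Finset V) := by simp
  have mk : k ∈ ({i, j, k} : Finset V) := by simp
  have eij : IsEdge 𝒯 i j := ⟨hij, _, hT, mi, mj⟩
  have eik : IsEdge 𝒯 i k := ⟨hik, _, hT, mi, mk⟩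
  have ejk : IsEdge 𝒯 j k := ⟨hjk, _, hT, mj, mk⟩
  have pa : 0 < C.len (f t) i j := C.lenPos _ ht _ _ eij
  have pb : 0 < C.len (f t) i k := C.lenPos _ ht _ _ eik
  have hab : C.len (f t) j k < C.len (f t) i j + C.len (f t) i k := by
    rw [C.len_comm _ i j, C.len_comm _ i k]
    exact C.triIneq _ ht _ hT j mj k mk i mi hjk hij.symm hik.symm
  have hac : C.len (f t) i j < C.len (f t) i k + C.len (f t) j k :=
    C.triIneq _ ht _ hT i mi j mj k mk hij hik hjk
  have hbc : C.len (f t) i k < C.len (f t) i j + C.len (f t) j k := by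
    rw [C.len_comm _ j k]
    exact C.triIneq _ ht _ hT i mi k mk j mj hik hij hjk.symm
  have hs := (sin_triAngle_pos pa pb hab hac hbc).ne'
  have hcos := cos_triAngle pa pb hab hac hbc
  have hm := C.metricCond _ ht _ hT i mi j mj k mk hij hik hjk
  refine ((C.hasDerivAt_len eij hf ht).triAngle (C.hasDerivAt_len eik hf ht)
    (C.hasDerivAt_len ejk hf ht) pa pb hab hac hbc).congr_deriv ?_
  rw [hh, hh, C.ang_comm _ i k j, ang]
  set g := triAngle (C.len (f t) i j) (C.len (f t) i k) (C.len (f t) j k)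
  rw [eq_div_iff (by positivity)] at hcos
  field_simp
  simp only [len] at hcos ⊢
  linear_combination (v j + v k) / 2 * hcos + (v j - v k) / 2 * hm

theorem hasDerivAt_K {f : ℝ → V → ℝ} {v : V → ℝ} {t : ℝ}
    (hf : HasDerivAt f v t) (ht : f t ∈ U) (i : V) :
    HasDerivAt (fun s => C.K (f s) i)
      (-∑ j, C.dualLen (f t) i j / C.len (f t) i j * (v j - v i)) t := by
  have hsum' : HasDerivAt (fun s => C.K (f s) i) (0 - (1 / 2) * ∑ j : V, ∑ k : V,
      if ({i, j, k} : Finset V) ∈ 𝒯 ∧ i ≠ j ∧ i ≠ k ∧ j ≠ k then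
        C.hh (f t) i j k / C.len (f t) i j * (v j - v i) +
        C.hh (f t) i k j / C.len (f t) i k * (v k - v i) else 0) t := by
    refine (hasDerivAt_const t _).sub (HasDerivAt.const_mul _ ?_)
    refine HasDerivAt.fun_sum fun j _ => HasDerivAt.fun_sum fun k _ => ?_
    split_ifs with h
    · exact C.hasDerivAt_ang h.1 h.2.1 h.2.2.1 h.2.2.2 hf ht
    · exact hasDerivAt_const _ _
  refine hsum'.congr_deriv ?_
  set A : V → V → ℝ := fun j k =>
    if ({i, j, k} : Finset V) ∈ 𝒯 ∧ i ≠ j ∧ i ≠ k ∧ j ≠ k then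
      C.hh (f t) i j k / C.len (f t) i j * (v j - v i) else 0 with hA
  have hsplit : ∀ j k, (if ({i, j, k} : Finset V) ∈ 𝒯 ∧ i ≠ j ∧ i ≠ k ∧ j ≠ k then
        C.hh (f t) i j k / C.len (f t) i j * (v j - v i) +
        C.hh (f t) i k j / C.len (f t) i k * (v k - v i) else 0) = A j k + A k j := by
    intro j k
    have hc : (({i, k, j} : Finset V) ∈ 𝒯 ∧ i ≠ k ∧ i ≠ j ∧ k ≠ j) ↔
        (({i, j, k} : Finset V) ∈ 𝒯 ∧ i ≠ j ∧ i ≠ k ∧ j ≠ k) := by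
      rw [Finset.pair_comm k j, ne_comm (a := k) (b := j)]
      tauto
    simp only [hA, hc]
    split_ifs <;> simp
  have hrow : ∀ j, ∑ k, A j k = C.dualLen (f t) i j / C.len (f t) i j * (v j - v i) := by
    intro j
    simp only [hA, dualLen, Finset.sum_div, Finset.sum_mul]
    refine Finset.sum_congr rfl fun k _ => ?_
    split_ifs <;> simp
  simp_rw [hsplit, Finset.sum_add_distrib]
  rw [Finset.sum_comm (f := fun j k => A k j)]
  simp_rw [hrow]
  ring

theorem dualLen_eq_zero_of_not_isEdge (f : V → ℝ) {i j : V} (h : ¬ IsEdge 𝒯 i j) :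
    C.dualLen f i j = 0 :=
  Finset.sum_eq_zero fun k _ => if_neg fun hk => h ⟨hk.2.1, _, hk.1, by simp, by simp⟩

end Conformal2D

/-- Discrete maximum principle: on a connected finite graph a function harmonic for
positive edge weights is constant. -/
theorem eq_of_sum_weight_mul_sub_eq_zero {V : Type*} [Fintype V] {G : SimpleGraph V}
    (hG : G.Connected) {w : V → V → ℝ} (hpos : ∀ i j, G.Adj i j → 0 < w i j)
    (hzero : ∀ i j, ¬ G.Adj i j → w i j = 0) {v : V → ℝ}
    (hv : ∀ i, ∑ j, w i j * (v j - v i) = 0) (i j : V) : v i = v j := by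
  have := hG.nonempty
  obtain ⟨m, hm⟩ := Finite.exists_max v
  have step : ∀ x y, G.Adj x y → v x = v m → v y = v m := by
    intro x y hxy hx
    have hle : ∀ z ∈ Finset.univ, w x z * (v z - v x) ≤ 0 := by
      intro z _
      by_cases hxz : G.Adj x z
      · exact mul_nonpos_of_nonneg_of_nonpos (hpos x z hxz).le (by linarith [hm z])
      · simp [hzero x z hxz]
    have := (Finset.sum_eq_zero_iff_of_nonpos hle).1 (hv x) y (Finset.mem_univ y)
    rcases mul_eq_zero.1 this with h | h
    · exact absurd h (hpos x y hxy).ne'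
    · linarith
  have walk : ∀ {a b : V}, G.Walk a b → v a = v m → v b = v m := by
    intro a b p
    induction p with
    | nil => exact id
    | cons h _ ih => exact fun ha => ih (step _ _ h ha)
  have all : ∀ x, v x = v m := fun x => (hG.preconnected m x).elim fun p => walk p rfl
  rw [all i, all j]

open Conformal2D in
/-- If a conformal variation keeps all vertex curvatures zero, the dual
lengths at `t = 0` are positive on every edge, and the edge graph is connected, then
the initial velocity `f′(0)` is constant on the vertices. -/
theorem rigidity_of_flat_metrics_2d {V : Type*} [Fintype V] [DecidableEq V]
    {𝒯 : Finset (Finset V)} {U : Set (V → ℝ)} (C : Conformal2D V 𝒯 U)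
    (ε : ℝ) (hε : 0 < ε) (f : ℝ → (V → ℝ))
    (hmem : ∀ t ∈ Set.Ioo (-ε) ε, f t ∈ U)
    (hsmooth : ContDiffOn ℝ (⊤ : ℕ∞) f (Set.Ioo (-ε) ε))
    (hflat : ∀ t ∈ Set.Ioo (-ε) ε, ∀ i : V, C.K (f t) i = 0)
    (hdual : ∀ i j : V, IsEdge 𝒯 i j → 0 < C.dualLen (f 0) i j)
    (hconn : (SimpleGraph.fromRel fun i j : V => IsEdge 𝒯 i j).Connected) :
    ∀ i j : V, deriv (fun t => f t i) 0 = deriv (fun t => f t j) 0 := by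
  have h0 : (0 : ℝ) ∈ Set.Ioo (-ε) ε := ⟨by linarith, hε⟩
  have hn : Set.Ioo (-ε) ε ∈ nhds (0 : ℝ) := isOpen_Ioo.mem_nhds h0
  have hf : HasDerivAt f (deriv f 0) 0 :=
    ((hsmooth.contDiffAt hn).differentiableAt (by simp)).hasDerivAt
  have hcoord : ∀ i, deriv (fun t => f t i) 0 = deriv f 0 i := fun i =>
    (hasDerivAt_pi.1 hf i).deriv
  have hadj : ∀ i j, (SimpleGraph.fromRel fun i j : V => IsEdge 𝒯 i j).Adj i j ↔
      IsEdge 𝒯 i j := by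
    intro i j
    rw [SimpleGraph.fromRel_adj]
    exact ⟨fun h => h.2.elim id IsEdge.symm, fun h => ⟨h.1, Or.inl h⟩⟩
  intro i j
  rw [hcoord, hcoord]
  refine eq_of_sum_weight_mul_sub_eq_zero hconn
    (w := fun i j => C.dualLen (f 0) i j / C.len (f 0) i j) ?_ ?_ ?_ i j
  · intro i j h
    rw [hadj] at h
    exact div_pos (hdual i j h) (C.lenPos _ (hmem 0 h0) _ _ h)
  · intro i j h
    rw [hadj] at h
    rw [C.dualLen_eq_zero_of_not_isEdge _ h, zero_div]
  · intro i
    have hK : HasDerivAt (fun t => C.K (f t) i) 0 0 :=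
      (hasDerivAt_const (0 : ℝ) (0 : ℝ)).congr_of_eventuallyEq
        (Filter.eventually_of_mem hn fun t ht => hflat t ht i)
    exact neg_eq_zero.1 ((C.hasDerivAt_K hf (hmem 0 h0) i).unique hK)
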